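/- For every n ≥ 2 and every k ≥ 1: g(v_n^{*k}, 2) ≤ (1 + Δ(H_n)/9)^{−k/2}. -/

import Mathlib

open MeasureTheory Matrix Finset
open scoped Real ComplexConjugate ComplexOrder

noncomputable section

instance {m n α : Type*} [MeasurableSpace α] : MeasurableSpace (Matrix m n α) :=
  inferInstanceAs (MeasurableSpace (m → n → α))

/-- The operator (spectral) norm of a complex matrix, i.e. the norm of the induced
linear map between Euclidean spaces. -/
def opNorm {m n : Type*} [Fintype m] [Fintype n] [DecidableEq n] (A : Matrix m n ℂ) : ℝ :=
  ‖LinearMap.toContinuousLinearMap (Matrix.toEuclideanLin A)‖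

/-- The spectral gap of a (positive semidefinite) matrix: its smallest nonzero
(= smallest positive) eigenvalue. -/
def specGap {d : Type*} [Fintype d] [DecidableEq d] (A : Matrix d d ℂ) : ℝ :=
  sInf {c : ℝ | 0 < c ∧ (c : ℂ) ∈ spectrum ℂ A}

/-- The matrix exponential, defined by its power series. -/
def mexp {d : Type*} [Fintype d] [DecidableEq d] (A : Matrix d d ℂ) : Matrix d d ℂ :=
  ∑' k : ℕ, ((k.factorial : ℂ))⁻¹ • A ^ k

/-- `U^{⊗t}` as a matrix, entrywise. -/
def tpow {d : Type*} [Fintype d] (t : ℕ) (U : Matrix d d ℂ) :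
    Matrix (Fin t → d) (Fin t → d) ℂ :=
  Matrix.of fun x y => ∏ i, U (x i) (y i)

/-- `U^{⊗t,t} = U^{⊗t} ⊗ (conj U)^{⊗t}` as a matrix, entrywise. -/
def tpow2 {d : Type*} [Fintype d] (t : ℕ) (U : Matrix d d ℂ) :
    Matrix ((Fin t → d) × (Fin t → d)) ((Fin t → d) × (Fin t → d)) ℂ :=
  Matrix.of fun x y => (∏ i, U (x.1 i) (y.1 i)) * ∏ i, conj (U (x.2 i) (y.2 i))

/-- The moment matrix `M_{v,t} = ∫ U^{⊗t,t} dv(U)` of a measure on the unitary group,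
defined entrywise. -/
def Mmat {d : Type*} [Fintype d] [DecidableEq d]
    (v : Measure (Matrix.unitaryGroup d ℂ)) (t : ℕ) :
    Matrix ((Fin t → d) × (Fin t → d)) ((Fin t → d) × (Fin t → d)) ℂ :=
  Matrix.of fun x y => ∫ U, tpow2 t (U : Matrix d d ℂ) x y ∂v

/-- `g(v,t) = ‖M_{v,t} - M_{μ,t}‖` where `μ` is the Haar measure. -/
def gfun {d : Type*} [Fintype d] [DecidableEq d]
    (μ v : Measure (Matrix.unitaryGroup d ℂ)) (t : ℕ) : ℝ :=
  opNorm (Mmat v t - Mmat μ t)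

/-- The Hilbert space of `n` qubits is indexed by bit strings `Fin n → Fin 2`. -/
abbrev QMat (n : ℕ) := Matrix (Fin n → Fin 2) (Fin n → Fin 2) ℂ

def pauliX : Matrix (Fin 2) (Fin 2) ℂ := !![0, 1; 1, 0]
def pauliZ : Matrix (Fin 2) (Fin 2) ℂ := !![1, 0; 0, -1]
def hadamardMat : Matrix (Fin 2) (Fin 2) ℂ :=
  (((Real.sqrt 2 : ℝ) : ℂ))⁻¹ • !![1, 1; 1, -1]

/-- A single-qubit operator `A` acting on qubit `i` of `n` qubits. -/
def op1 {n : ℕ} (i : Fin n) (A : Matrix (Fin 2) (Fin 2) ℂ) : QMat n :=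
  Matrix.of fun x y =>
    A (x i) (y i) * ∏ j ∈ Finset.univ.erase i, (if x j = y j then (1 : ℂ) else 0)

/-- Pauli `X` on qubit `i`. -/
def Xop {n : ℕ} (i : Fin n) : QMat n := op1 i pauliX
/-- Pauli `Z` on qubit `i`. -/
def Zop {n : ℕ} (i : Fin n) : QMat n := op1 i pauliZ

/-- `ZXZ_i = Z_{i-1} X_i Z_{i+1}`, with the `Z` factors dropped at the boundary
(so `ZXZ_1 = X_1 Z_2` and `ZXZ_n = Z_{n-1} X_n`). -/
def ZXZop {n : ℕ} (i : Fin n) : QMat n :=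
  (if h : 0 < (i : ℕ) then Zop ⟨(i : ℕ) - 1, by have := i.isLt; omega⟩ else 1) *
    Xop i *
    (if h : (i : ℕ) + 1 < n then Zop ⟨(i : ℕ) + 1, h⟩ else 1)

/-- The gate `e^{iφ A}`. -/
def rotGate {n : ℕ} (φ : ℝ) (A : QMat n) : QMat n :=
  mexp ((Complex.I * (φ : ℂ)) • A)

/-- The uniform probability measure on the box `[0, 2π)^ι`. -/
def unifBox (ι : Type*) [Fintype ι] : Measure (ι → ℝ) :=
  (ENNReal.ofReal ((2 * Real.pi) ^ (Fintype.card ι)))⁻¹ •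
    MeasureTheory.volume.restrict (Set.univ.pi fun _ => Set.Ico 0 (2 * Real.pi))

/-- The random circuit of the distribution `v_n`:
`U = (∏ᵢ e^{iφ⁰ᵢ ZXZᵢ})(∏ᵢ e^{iφ¹ᵢ Zᵢ})(∏ᵢ e^{iφ²ᵢ Xᵢ})`. -/
def vnCircuit {n : ℕ} (φ : Fin 3 → Fin n → ℝ) : QMat n :=
  (List.ofFn fun i : Fin n => rotGate (φ 0 i) (ZXZop i)).prod *
    (List.ofFn fun i : Fin n => rotGate (φ 1 i) (Zop i)).prod *
    (List.ofFn fun i : Fin n => rotGate (φ 2 i) (Xop i)).prod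

/-- `P_A := (1/2π)∫₀^{2π} (e^{iφA})^{⊗2,2} dφ`, defined entrywise. -/
def Pproj {n : ℕ} (A : QMat n) :
    Matrix ((Fin 2 → (Fin n → Fin 2)) × (Fin 2 → (Fin n → Fin 2)))
           ((Fin 2 → (Fin n → Fin 2)) × (Fin 2 → (Fin n → Fin 2))) ℂ :=
  Matrix.of fun x y =>
    ((2 * Real.pi : ℝ) : ℂ)⁻¹ * ∫ φ in (0 : ℝ)..(2 * Real.pi), tpow2 2 (rotGate φ A) x y

/-- `H_n = ∑ᵢ (1 - P^X_i) + ∑ᵢ (1 - P^Z_i) + ∑ᵢ (1 - P^{ZXZ}_i)`. -/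
def Hham (n : ℕ) :
    Matrix ((Fin 2 → (Fin n → Fin 2)) × (Fin 2 → (Fin n → Fin 2)))
           ((Fin 2 → (Fin n → Fin 2)) × (Fin 2 → (Fin n → Fin 2))) ℂ :=
  (∑ i : Fin n, (1 - Pproj (Xop i))) + (∑ i : Fin n, (1 - Pproj (Zop i))) +
    (∑ i : Fin n, (1 - Pproj (ZXZop i)))

/-- `H^L_n = H_n - (1 - P^{ZXZ}_n)` (boundary term at the right edge removed). -/
def HhamL (n : ℕ) (hn : 0 < n) :
    Matrix ((Fin 2 → (Fin n → Fin 2)) × (Fin 2 → (Fin n → Fin 2)))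
           ((Fin 2 → (Fin n → Fin 2)) × (Fin 2 → (Fin n → Fin 2))) ℂ :=
  Hham n - (1 - Pproj (ZXZop (⟨n - 1, by omega⟩ : Fin n)))

/-- `H^B_n = H_n - (1 - P^{ZXZ}_1) - (1 - P^{ZXZ}_n)` (both boundary terms removed). -/
def HhamB (n : ℕ) (hn : 0 < n) :
    Matrix ((Fin 2 → (Fin n → Fin 2)) × (Fin 2 → (Fin n → Fin 2)))
           ((Fin 2 → (Fin n → Fin 2)) × (Fin 2 → (Fin n → Fin 2))) ℂ :=
  HhamL n hn - (1 - Pproj (ZXZop (⟨0, hn⟩ : Fin n)))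

/-- The moment matrix `M_{v_n^{*k},2}` of the `k`-fold convolution of `v_n`, written as
an integral over `k` independent families of uniformly distributed angles. -/
def MvnPowMat (n k : ℕ) :
    Matrix ((Fin 2 → (Fin n → Fin 2)) × (Fin 2 → (Fin n → Fin 2)))
           ((Fin 2 → (Fin n → Fin 2)) × (Fin 2 → (Fin n → Fin 2))) ℂ :=
  Matrix.of fun x y =>
    ∫ φ : Fin k × (Fin 3 × Fin n) → ℝ,
      tpow2 2 ((List.ofFn fun j : Fin k => vnCircuit fun a i => φ (j, (a, i))).prod) x y
      ∂(unifBox (Fin k × (Fin 3 × Fin n)))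

/-! ### Tensor products of matrices -/

/-- The tensor product `⨂ᵢ Mᵢ` as a matrix, entrywise. -/
def tensor {ι d : Type*} [Fintype ι] (M : ι → Matrix d d ℂ) : Matrix (ι → d) (ι → d) ℂ :=
  Matrix.of fun x y => ∏ i, M i (x i) (y i)

section Tensor

variable {ι d : Type*} [Fintype ι]

lemma tensor_apply (M : ι → Matrix d d ℂ) (x y : ι → d) :
    tensor M x y = ∏ i, M i (x i) (y i) := rfl

lemma tensor_conjTranspose (M : ι → Matrix d d ℂ) :
    (tensor M)ᴴ = tensor fun i => (M i)ᴴ := by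
  ext x y
  simp [tensor_apply, conjTranspose_apply]

lemma tensor_one [DecidableEq d] : tensor (1 : ι → Matrix d d ℂ) = 1 := by
  classical
  ext x y
  by_cases h : x = y
  · subst h; simp [tensor_apply]
  · obtain ⟨i, hi⟩ := Function.ne_iff.mp h
    rw [one_apply_ne h, tensor_apply]
    exact Finset.prod_eq_zero (mem_univ i) (by simp [hi])

variable [DecidableEq ι]

lemma tensor_mul [Fintype d] (M N : ι → Matrix d d ℂ) :
    tensor M * tensor N = tensor (M * N) := by
  ext x y
  simp only [mul_apply, tensor_apply, Pi.mul_apply, ← Finset.prod_mul_distrib]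
  rw [Finset.prod_univ_sum, Fintype.piFinset_univ]

lemma tensor_update_apply (M : ι → Matrix d d ℂ) (i : ι) (A : Matrix d d ℂ) (x y : ι → d) :
    tensor (Function.update M i A) x y =
      A (x i) (y i) * ∏ j ∈ univ.erase i, M j (x j) (y j) := by
  rw [tensor_apply, ← Finset.mul_prod_erase _ _ (mem_univ i), Function.update_self]
  congr 1
  refine Finset.prod_congr rfl fun j hj => ?_
  rw [Function.update_of_ne (Finset.ne_of_mem_erase hj)]

lemma tensor_update_add (M : ι → Matrix d d ℂ) (i : ι) (A B : Matrix d d ℂ) :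
    tensor (Function.update M i (A + B)) =
      tensor (Function.update M i A) + tensor (Function.update M i B) := by
  ext x y
  simp [tensor_update_apply, add_mul]

lemma tensor_update_sub (M : ι → Matrix d d ℂ) (i : ι) (A B : Matrix d d ℂ) :
    tensor (Function.update M i (A - B)) =
      tensor (Function.update M i A) - tensor (Function.update M i B) := by
  ext x y
  simp [tensor_update_apply, sub_mul]

lemma tensor_update_smul (M : ι → Matrix d d ℂ) (i : ι) (c : ℂ) (A : Matrix d d ℂ) :
    tensor (Function.update M i (c • A)) = c • tensor (Function.update M i A) := by
  ext x y
  simp [tensor_update_apply, mul_assoc]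

omit [DecidableEq ι] in
lemma tensor_smul (s : ι → ℂ) (M : ι → Matrix d d ℂ) :
    tensor (fun i => s i • M i) = (∏ i, s i) • tensor M := by
  ext x y
  simp [tensor_apply, Finset.prod_mul_distrib]

/-- The commutator of two product operators whose factors commute at all sites but one. -/
lemma tensor_commutator [Fintype d] {M N : ι → Matrix d d ℂ} (i : ι)
    (h : ∀ k, k ≠ i → M k * N k = N k * M k) :
    tensor M * tensor N - tensor N * tensor M =
      tensor (Function.update (M * N) i (M i * N i - N i * M i)) := by
  rw [tensor_update_sub, tensor_mul, tensor_mul]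
  congr 2
  · exact (Function.update_eq_self i (M * N)).symm
  · funext k
    by_cases hk : k = i
    · subst hk; simp
    · simp [hk, h k hk]

lemma tensor_commute_of_prod_eq_one [Fintype d] {M N : ι → Matrix d d ℂ} (s : ι → ℂ)
    (h : ∀ k, M k * N k = s k • (N k * M k)) (hs : ∏ k, s k = 1) :
    Commute (tensor M) (tensor N) := by
  have : M * N = fun k => s k • (N * M) k := funext h
  rw [commute_iff_eq, tensor_mul, tensor_mul, this, tensor_smul, hs, one_smul]

omit [DecidableEq ι] in
lemma single_eq_tensor [DecidableEq d] (x y : ι → d) :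
    Matrix.single x y (1 : ℂ) = tensor fun i => Matrix.single (x i) (y i) 1 := by
  ext a b
  rw [tensor_apply]
  by_cases h : x = a ∧ y = b
  · obtain ⟨rfl, rfl⟩ := h
    simp
  · rw [Matrix.single_apply, if_neg h]
    have : ∃ i, ¬ (x i = a i ∧ y i = b i) := by
      by_contra! hc
      exact h ⟨funext fun i => (hc i).1, funext fun i => (hc i).2⟩
    obtain ⟨i, hi⟩ := this
    exact (Finset.prod_eq_zero (mem_univ i) (by rw [Matrix.single_apply, if_neg hi])).symm

end Tensor

/-! ### The tensor powers `U^{⊗t}` and `U^{⊗t,t}` -/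

section TensorPower

open scoped Kronecker

variable {d : Type*} [Fintype d]

lemma tpow_eq_tensor (t : ℕ) (U : Matrix d d ℂ) : tpow t U = tensor fun _ => U := rfl

lemma tpow2_eq_kronecker (t : ℕ) (U : Matrix d d ℂ) :
    tpow2 t U = tpow t U ⊗ₖ (tpow t U).map conj := by
  ext x y
  simp [tpow2, tpow, map_prod]

lemma tpow_mul (t : ℕ) (U V : Matrix d d ℂ) : tpow t (U * V) = tpow t U * tpow t V := by
  classical
  simp only [tpow_eq_tensor, tensor_mul]
  rfl

lemma tpow_conjTranspose (t : ℕ) (U : Matrix d d ℂ) : tpow t Uᴴ = (tpow t U)ᴴ := by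
  simp only [tpow_eq_tensor, tensor_conjTranspose]

lemma tpow2_mul (t : ℕ) (U V : Matrix d d ℂ) : tpow2 t (U * V) = tpow2 t U * tpow2 t V := by
  simp only [tpow2_eq_kronecker, tpow_mul]
  rw [← mul_kronecker_mul, Matrix.map_mul]

lemma tpow2_conjTranspose (t : ℕ) (U : Matrix d d ℂ) : tpow2 t Uᴴ = (tpow2 t U)ᴴ := by
  rw [tpow2_eq_kronecker, tpow2_eq_kronecker, conjTranspose_kronecker, tpow_conjTranspose]
  rfl

lemma tpow2_one [DecidableEq d] (t : ℕ) : tpow2 t (1 : Matrix d d ℂ) = 1 := by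
  have : tpow t (1 : Matrix d d ℂ) = 1 := tensor_one
  rw [tpow2_eq_kronecker, this, Matrix.map_one _ (map_zero _) (map_one _), one_kronecker_one]

lemma tpow2_list_prod [DecidableEq d] (t : ℕ) (l : List (Matrix d d ℂ)) :
    tpow2 t l.prod = (l.map (tpow2 t)).prod := by
  induction l with
  | nil => simp [tpow2_one]
  | cons A l ih => simp [tpow2_mul, ih]

/-- `U^{⊗t,t}` acts on vectorised operators by conjugation with `U^{⊗t}`. -/
lemma tpow2_mulVec (t : ℕ) (U : Matrix d d ℂ) (v : (Fin t → d) × (Fin t → d) → ℂ)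
    (a b : Fin t → d) :
    (tpow2 t U *ᵥ v) (a, b) =
      (tpow t U * Matrix.of (fun c e => v (c, e)) * (tpow t U)ᴴ) a b := by
  rw [tpow2_eq_kronecker]
  simp only [mulVec, dotProduct, kroneckerMap_apply, map_apply, mul_apply, of_apply,
    conjTranspose_apply, Fintype.sum_prod_type, Finset.sum_mul]
  rw [Finset.sum_comm]
  refine Finset.sum_congr rfl fun e _ => Finset.sum_congr rfl fun c _ => ?_
  rw [starRingEnd_apply]
  ring

end TensorPower

/-! ### Pauli strings generate all matrices as a Lie algebra -/

/-- A nonidentity Pauli matrix, up to phase. -/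
def IsPauli (A : Matrix (Fin 2) (Fin 2) ℂ) : Prop :=
  A = pauliX ∨ A = pauliZ ∨ A = pauliX * pauliZ

lemma isPauli_pauliX : IsPauli pauliX := Or.inl rfl

lemma isPauli_pauliZ : IsPauli pauliZ := Or.inr (Or.inl rfl)

lemma pauliX_mul_self : pauliX * pauliX = 1 := by
  ext i j; fin_cases i <;> fin_cases j <;> simp [pauliX, mul_apply]

lemma pauliZ_mul_self : pauliZ * pauliZ = 1 := by
  ext i j; fin_cases i <;> fin_cases j <;> simp [pauliZ, mul_apply]

lemma pauliZ_mul_pauliX : pauliZ * pauliX = (-1 : ℂ) • (pauliX * pauliZ) := by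
  ext i j; fin_cases i <;> fin_cases j <;> simp [pauliX, pauliZ, mul_apply]

lemma pauliX_mul_pauliZ : pauliX * pauliZ = (-1 : ℂ) • (pauliZ * pauliX) := by
  rw [pauliZ_mul_pauliX, smul_smul]; simp

lemma pauliX_conjTranspose : pauliXᴴ = pauliX := by
  ext i j; fin_cases i <;> fin_cases j <;> simp [pauliX, conjTranspose_apply]

lemma pauliZ_conjTranspose : pauliZᴴ = pauliZ := by
  ext i j; fin_cases i <;> fin_cases j <;> simp [pauliZ, conjTranspose_apply]

/-- Every nonidentity Pauli is a commutator of two others. -/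
lemma IsPauli.exists_commutator_eq {B : Matrix (Fin 2) (Fin 2) ℂ} (hB : IsPauli B) :
    ∃ C D, IsPauli C ∧ IsPauli D ∧ ∃ c : ℂ, c ≠ 0 ∧ C * D - D * C = c • B := by
  rcases hB with rfl | rfl | rfl
  · refine ⟨pauliZ, pauliX * pauliZ, .inr (.inl rfl), .inr (.inr rfl), -2, by simp, ?_⟩
    ext i j; fin_cases i <;> fin_cases j <;>
      simp [pauliX, pauliZ] <;> norm_num
  · refine ⟨pauliX, pauliX * pauliZ, .inl rfl, .inr (.inr rfl), 2, by simp, ?_⟩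
    ext i j; fin_cases i <;> fin_cases j <;>
      simp [pauliX, pauliZ] <;> norm_num
  · refine ⟨pauliX, pauliZ, .inl rfl, .inr (.inl rfl), 2, by simp, ?_⟩
    ext i j; fin_cases i <;> fin_cases j <;>
      simp [pauliX, pauliZ] <;> norm_num

/-- Two nonidentity Paulis are either proportional to a commutator `[A, C]` of one another
or equal. -/
lemma IsPauli.eq_or_commutator {A B : Matrix (Fin 2) (Fin 2) ℂ} (hA : IsPauli A)
    (hB : IsPauli B) :
    A = B ∨ ∃ C, IsPauli C ∧ ∃ c : ℂ, c ≠ 0 ∧ A * C - C * A = c • B := by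
  rcases hA with rfl | rfl | rfl <;> rcases hB with rfl | rfl | rfl
  · exact .inl rfl
  · refine .inr ⟨pauliX * pauliZ, .inr (.inr rfl), 2, by simp, ?_⟩
    ext i j; fin_cases i <;> fin_cases j <;>
      simp [pauliX, pauliZ] <;> norm_num
  · refine .inr ⟨pauliZ, .inr (.inl rfl), 2, by simp, ?_⟩
    ext i j; fin_cases i <;> fin_cases j <;>
      simp [pauliX, pauliZ] <;> norm_num
  · refine .inr ⟨pauliX * pauliZ, .inr (.inr rfl), -2, by simp, ?_⟩
    ext i j; fin_cases i <;> fin_cases j <;>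
      simp [pauliX, pauliZ] <;> norm_num
  · exact .inl rfl
  · refine .inr ⟨pauliX, .inl rfl, -2, by simp, ?_⟩
    ext i j; fin_cases i <;> fin_cases j <;>
      simp [pauliX, pauliZ] <;> norm_num
  · refine .inr ⟨pauliZ, .inr (.inl rfl), 2, by simp, ?_⟩
    ext i j; fin_cases i <;> fin_cases j <;>
      simp [pauliX, pauliZ] <;> norm_num
  · refine .inr ⟨pauliX, .inl rfl, -2, by simp, ?_⟩
    ext i j; fin_cases i <;> fin_cases j <;>
      simp [pauliX, pauliZ] <;> norm_num
  · exact .inl rfl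

/-- Every `2 × 2` matrix is a combination of Paulis. -/
lemma eq_sum_pauli (A : Matrix (Fin 2) (Fin 2) ℂ) :
    A = ((A 0 0 + A 1 1) / 2) • 1 + ((A 0 1 + A 1 0) / 2) • pauliX +
      ((A 0 0 - A 1 1) / 2) • pauliZ + ((A 1 0 - A 0 1) / 2) • (pauliX * pauliZ) := by
  ext i j; fin_cases i <;> fin_cases j <;> simp [pauliX, pauliZ] <;> ring

section Generation

variable {n : ℕ}

lemma op1_eq_tensor (i : Fin n) (A : Matrix (Fin 2) (Fin 2) ℂ) :
    op1 i A = tensor (Function.update 1 i A) := by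
  ext x y
  rw [tensor_update_apply]
  simp [op1, one_apply]

/-- The local factors of `ZXZᵢ`. -/
def zxzFactor (i k : Fin n) : Matrix (Fin 2) (Fin 2) ℂ :=
  if k = i then pauliX
  else if (k : ℕ) + 1 = i ∨ (i : ℕ) + 1 = k then pauliZ else 1

lemma ZXZop_eq_tensor (i : Fin n) : ZXZop i = tensor (zxzFactor i) := by
  have hone : (1 : QMat n) = tensor 1 := tensor_one.symm
  have key : ∀ M N K : Fin n → Matrix (Fin 2) (Fin 2) ℂ, M * N * K = zxzFactor i →
      tensor M * tensor N * tensor K = tensor (zxzFactor i) := by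
    intro M N K h
    rw [tensor_mul, tensor_mul, h]
  unfold ZXZop Xop Zop
  simp only [op1_eq_tensor]
  split_ifs with h1 h2 h2 <;> (try rw [hone]) <;> refine key _ _ _ ?_ <;> funext k <;>
    simp only [Pi.mul_apply, Pi.one_apply, zxzFactor, Function.update_apply, Fin.ext_iff] <;>
    split_ifs <;> first | omega | simp

variable {S : Submodule ℂ (QMat n)}
  (hS : ∀ A B, A ∈ S → B ∈ S → A * B - B * A ∈ S)

include hS in
/-- Commutator rule for product operators which fail to commute at exactly one site. -/
lemma tensor_mem_of_commutator {M N K : Fin n → Matrix (Fin 2) (Fin 2) ℂ} (i : Fin n)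
    (s : Fin n → ℂ) (hs : ∀ k, s k ≠ 0) (hM : tensor M ∈ S) (hN : tensor N ∈ S)
    (hk : ∀ k, k ≠ i → M k * N k = N k * M k ∧ M k * N k = s k • K k)
    (hi : M i * N i - N i * M i = s i • K i) : tensor K ∈ S := by
  have h := hS _ _ hM hN
  rw [tensor_commutator i fun k hki => (hk k hki).1] at h
  have : Function.update (M * N) i (M i * N i - N i * M i) = fun k => s k • K k := by
    funext k
    by_cases hki : k = i
    · subst hki; simp [hi]
    · simp [hki, (hk k hki).2]
  rw [this, tensor_smul] at h
  exact (S.smul_mem_iff (Finset.prod_ne_zero_iff.mpr fun k _ => hs k)).mp h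

variable (hone : (1 : QMat n) ∈ S) (hX : ∀ i, Xop i ∈ S) (hZ : ∀ i, Zop i ∈ S)
  (hZXZ : ∀ i, ZXZop i ∈ S)

include hS hX hZ in
lemma op1_mem_of_isPauli (i : Fin n) {A : Matrix (Fin 2) (Fin 2) ℂ} (hA : IsPauli A) :
    tensor (Function.update 1 i A) ∈ S := by
  have hX' : tensor (Function.update 1 i pauliX) ∈ S := op1_eq_tensor i pauliX ▸ hX i
  have hZ' : tensor (Function.update 1 i pauliZ) ∈ S := op1_eq_tensor i pauliZ ▸ hZ i
  rcases hA with rfl | rfl | rfl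
  · exact hX'
  · exact hZ'
  · refine tensor_mem_of_commutator hS i (Function.update 1 i 2) (fun k => ?_) hX' hZ'
      (fun k hk => ?_) ?_
    · rw [Function.update_apply]; split_ifs <;> simp
    · simp [hk]
    · simp only [Function.update_self, pauliZ_mul_pauliX]
      module

include hS hX hZ in
/-- A nonidentity Pauli factor may be exchanged for any other one. -/
lemma tensor_update_mem_of_isPauli {M : Fin n → Matrix (Fin 2) (Fin 2) ℂ} (hM : tensor M ∈ S)
    (i : Fin n) (hMi : IsPauli (M i)) {B : Matrix (Fin 2) (Fin 2) ℂ} (hB : IsPauli B) :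
    tensor (Function.update M i B) ∈ S := by
  rcases hMi.eq_or_commutator hB with h | ⟨C, hC, c, hc, h⟩
  · rwa [← h, Function.update_eq_self]
  · refine tensor_mem_of_commutator hS i (Function.update 1 i c) (fun k => ?_) hM
      (op1_mem_of_isPauli hS hX hZ i hC) (fun k hk => ?_) ?_
    · rw [Function.update_apply]; split_ifs <;> simp [hc]
    · simp [hk]
    · simpa using h

include hS hX hZ in
lemma pair_mem_of_pair_mem {i j : Fin n} (hij : i ≠ j) {A B C D : Matrix (Fin 2) (Fin 2) ℂ}
    (hA : IsPauli A) (hB : IsPauli B) (hC : IsPauli C) (hD : IsPauli D)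
    (h : tensor (Function.update (Function.update 1 i A) j B) ∈ S) :
    tensor (Function.update (Function.update 1 i C) j D) ∈ S := by
  have h1 := tensor_update_mem_of_isPauli hS hX hZ h i (by simpa [hij] using hA) hC
  have h2 := tensor_update_mem_of_isPauli hS hX hZ h1 j (by simpa [hij.symm] using hB) hD
  convert h2 using 2
  funext k
  simp only [Function.update_apply]
  split_ifs <;> simp_all

include hS hX hZ hZXZ in
/-- All nearest-neighbour Pauli pairs are generated. -/
lemma pair_mem (m : ℕ) (hm : m + 1 < n) {C D : Matrix (Fin 2) (Fin 2) ℂ}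
    (hC : IsPauli C) (hD : IsPauli D) :
    tensor (Function.update (Function.update 1 (⟨m, by omega⟩ : Fin n) C) ⟨m + 1, hm⟩ D) ∈ S := by
  induction m generalizing C D with
  | zero =>
    refine pair_mem_of_pair_mem hS hX hZ (by simp) isPauli_pauliX isPauli_pauliZ hC hD ?_
    have h := hZXZ ⟨0, by omega⟩
    rw [ZXZop_eq_tensor] at h
    convert h using 2
    funext k
    simp only [Function.update_apply, zxzFactor, Fin.ext_iff, Pi.one_apply]
    split_ifs <;> first | rfl | grind
  | succ m ih =>
    refine pair_mem_of_pair_mem hS hX hZ (by simp) (.inr (.inr rfl)) isPauli_pauliZ hC hD ?_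
    have h := hZXZ ⟨m + 1, by omega⟩
    rw [ZXZop_eq_tensor] at h
    refine tensor_mem_of_commutator hS ⟨m + 1, by omega⟩
      (Function.update 1 ⟨m + 1, by omega⟩ 2) (fun k => ?_) h
      (ih (by omega) isPauli_pauliZ isPauli_pauliZ) (fun k hk => ?_) ?_
    · rw [Function.update_apply]; split_ifs <;> simp
    · simp only [Function.update_apply, zxzFactor, Fin.ext_iff, Pi.one_apply, ne_eq] at hk ⊢
      split_ifs <;> first | omega | simp [pauliZ_mul_self]
    · simp [zxzFactor, pauliZ_mul_pauliX]
      module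

include hS hone hX hZ hZXZ in
/-- All Pauli strings supported on the first `m` sites are generated. -/
lemma pauliString_mem_of_support (m : ℕ) (p : Fin n → Matrix (Fin 2) (Fin 2) ℂ)
    (hp : ∀ i, p i = 1 ∨ IsPauli (p i)) (hsupp : ∀ i : Fin n, m ≤ (i : ℕ) → p i = 1) :
    tensor p ∈ S := by
  induction m generalizing p with
  | zero =>
    have : p = 1 := funext fun i => hsupp i (Nat.zero_le _)
    rwa [this, tensor_one]
  | succ m ih =>
    by_cases hmn : m < n
    swap
    · exact ih p hp fun i hi => absurd i.isLt (by omega)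
    rcases hp ⟨m, hmn⟩ with hB | hB
    · refine ih p hp fun i hi => ?_
      rcases hi.eq_or_lt with h | h
      · rwa [show i = ⟨m, hmn⟩ from Fin.ext h.symm]
      · exact hsupp i h
    cases m with
    | zero =>
      have : p = Function.update (1 : Fin n → Matrix (Fin 2) (Fin 2) ℂ) ⟨0, hmn⟩
          (p ⟨0, hmn⟩) := by
        funext k
        by_cases hk : k = ⟨0, hmn⟩
        · subst hk; simp
        · simp only [Function.update_of_ne hk, Pi.one_apply]
          exact hsupp k (Nat.one_le_iff_ne_zero.mpr fun h => hk (Fin.ext h))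
      rw [this]
      exact op1_mem_of_isPauli hS hX hZ _ hB
    | succ m =>
      set a : Fin n := ⟨m, by omega⟩ with ha
      set b : Fin n := ⟨m + 1, hmn⟩ with hb
      have hab : a ≠ b := by simp [ha, hb]
      /- Strings with a nonidentity factor at `a`: grow the support by one site. -/
      have grow : ∀ q : Fin n → Matrix (Fin 2) (Fin 2) ℂ, (∀ i, q i = 1 ∨ IsPauli (q i)) →
          (∀ i : Fin n, m + 1 + 1 ≤ (i : ℕ) → q i = 1) → IsPauli (q a) → IsPauli (q b) →
          tensor q ∈ S := by
        intro q hq hqs hqa hqb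
        obtain ⟨C, D, hC, hD, c, hc, hCD⟩ := hqa.exists_commutator_eq
        have h1 : tensor (Function.update (Function.update q a C) b 1) ∈ S := by
          refine ih _ (fun i => ?_) fun i hi => ?_
          · simp only [Function.update_apply]
            split_ifs
            · exact .inl rfl
            · exact .inr hC
            · exact hq i
          · simp only [Function.update_apply]
            split_ifs with h2 h3
            · rfl
            · subst h3; simp [ha] at hi
            · refine hqs i ?_
              rcases hi.eq_or_lt with h | h
              · exact absurd (Fin.ext h.symm) h2
              · exact h
        have h2 := pair_mem hS hX hZ hZXZ m hmn hD hqb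
        refine tensor_mem_of_commutator hS a (Function.update 1 a c) (fun k => ?_) h1 h2
          (fun k hk => ?_) ?_
        · rw [Function.update_apply]; split_ifs <;> simp [hc]
        · simp only [← ha, ← hb, Function.update_apply, hk, if_false, Pi.one_apply]
          split_ifs with h
          · simp [h]
          · simp
        · simpa [← ha, ← hb, hab] using hCD
      rcases hp a with hA | hA
      swap
      · exact grow p hp hsupp hA hB
      /- Otherwise grow a string with a factor at `a`, and then erase that factor. -/
      obtain ⟨C, D, hC, hD, c, hc, hCD⟩ := hB.exists_commutator_eq
      have h1 : tensor (Function.update (Function.update p a pauliX) b C) ∈ S := by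
        refine grow _ (fun i => ?_) (fun i hi => ?_) ?_ ?_
        · simp only [Function.update_apply]
          split_ifs
          · exact .inr hC
          · exact .inr isPauli_pauliX
          · exact hp i
        · have hia : i ≠ a := fun h => by subst h; simp [ha] at hi
          have hib : i ≠ b := fun h => by subst h; simp [hb] at hi
          simpa [hia, hib] using hsupp i hi
        · simpa [hab] using isPauli_pauliX
        · simpa using hC
      have h2 := pair_mem hS hX hZ hZXZ m hmn isPauli_pauliX hD
      refine tensor_mem_of_commutator hS b (Function.update 1 b c) (fun k => ?_) h1 h2
        (fun k hk => ?_) ?_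
      · rw [Function.update_apply]; split_ifs <;> simp [hc]
      · simp only [← ha, ← hb, Function.update_apply, hk, if_false, Pi.one_apply]
        split_ifs with h
        · simp [h, hA, pauliX_mul_self]
        · simp
      · simpa [← ha, ← hb] using hCD

include hS hone hX hZ hZXZ in
/-- The Lie algebra generated by `1`, `Xᵢ`, `Zᵢ`, `ZXZᵢ` contains every matrix. -/
lemma mem_of_generators (U : QMat n) : U ∈ S := by
  have key : ∀ (s : Finset (Fin n)) (M : Fin n → Matrix (Fin 2) (Fin 2) ℂ),
      (∀ i ∉ s, M i = 1 ∨ IsPauli (M i)) → tensor M ∈ S := by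
    intro s
    induction s using Finset.induction_on with
    | empty =>
      intro M hM
      exact pauliString_mem_of_support hS hone hX hZ hZXZ n M (fun i => hM i (by simp))
        fun i hi => absurd i.isLt (by omega)
    | insert a s ha ih =>
      intro M hM
      have hmem : ∀ A, (A = 1 ∨ IsPauli A) → tensor (Function.update M a A) ∈ S := by
        intro A hA
        refine ih _ fun i hi => ?_
        rw [Function.update_apply]
        split_ifs with h
        · exact hA
        · exact hM i (by simp [h, hi])
      rw [← Function.update_eq_self a M, eq_sum_pauli (M a)]
      simp only [tensor_update_add, tensor_update_smul]
      exact S.add_mem (S.add_mem (S.add_mem (S.smul_mem _ (hmem _ (.inl rfl)))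
        (S.smul_mem _ (hmem _ (.inr (.inl rfl))))) (S.smul_mem _ (hmem _ (.inr (.inr (.inl rfl))))))
        (S.smul_mem _ (hmem _ (.inr (.inr (.inr rfl)))))
  rw [matrix_eq_sum_single U]
  refine S.sum_mem fun x _ => S.sum_mem fun y _ => ?_
  rw [show Matrix.single x y (U x y) = U x y • Matrix.single x y (1 : ℂ) by
    rw [smul_single]; simp, single_eq_tensor]
  exact S.smul_mem _ (key univ _ fun i hi => absurd (mem_univ i) hi)

end Generation

/-! ### Operators commuting with the Lie algebra action on two copies -/

section TwoCopies

variable {d : Type*} [Fintype d] [DecidableEq d]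

/-- The Lie algebra action `A ⊗ 1 + 1 ⊗ A` on two copies. -/
def lieTwo (A : Matrix d d ℂ) : Matrix (Fin 2 → d) (Fin 2 → d) ℂ :=
  tensor ![A, 1] + tensor ![1, A]

omit [Fintype d] [DecidableEq d] in
lemma tensor_pair_apply (A B : Matrix d d ℂ) (x y : Fin 2 → d) :
    tensor ![A, B] x y = A (x 0) (y 0) * B (x 1) (y 1) := by
  simp [tensor_apply, Fin.prod_univ_two]

omit [DecidableEq d] in
lemma tensor_pair_mul (A B C D : Matrix d d ℂ) :
    tensor ![A, B] * tensor ![C, D] = tensor ![A * C, B * D] := by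
  rw [tensor_mul]
  congr 1
  funext i
  fin_cases i <;> rfl

omit [Fintype d] in
lemma lieTwo_add (A B : Matrix d d ℂ) : lieTwo (A + B) = lieTwo A + lieTwo B := by
  ext x y
  simp only [lieTwo, Matrix.add_apply, tensor_pair_apply]
  ring

omit [Fintype d] in
lemma lieTwo_smul (c : ℂ) (A : Matrix d d ℂ) : lieTwo (c • A) = c • lieTwo A := by
  ext x y
  simp only [lieTwo, Matrix.add_apply, Matrix.smul_apply, tensor_pair_apply, smul_eq_mul]
  ring

lemma lieTwo_mul (A B : Matrix d d ℂ) :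
    lieTwo A * lieTwo B = lieTwo (A * B) + (tensor ![A, B] + tensor ![B, A]) := by
  simp only [lieTwo, mul_add, add_mul, tensor_pair_mul, one_mul, mul_one]
  abel

lemma lieTwo_commutator (A B : Matrix d d ℂ) :
    lieTwo (A * B - B * A) = lieTwo A * lieTwo B - lieTwo B * lieTwo A := by
  rw [lieTwo_mul, lieTwo_mul, sub_eq_add_neg, lieTwo_add, ← neg_one_smul ℂ, lieTwo_smul]
  module

/-- The matrices whose action on two copies commutes with `V`. -/
def lieCommutant (V : Matrix (Fin 2 → d) (Fin 2 → d) ℂ) : Submodule ℂ (Matrix d d ℂ) where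
  carrier := {A | Commute V (lieTwo A)}
  add_mem' {A B} hA hB := by
    simpa only [Set.mem_ofPred_eq, lieTwo_add] using Commute.add_right hA hB
  zero_mem' := by
    have : lieTwo (0 : Matrix d d ℂ) = 0 := by simpa using lieTwo_smul 0 (0 : Matrix d d ℂ)
    simp [this]
  smul_mem' c A hA := by
    simpa only [Set.mem_ofPred_eq, lieTwo_smul] using Commute.smul_right hA c

lemma mem_lieCommutant {V : Matrix (Fin 2 → d) (Fin 2 → d) ℂ} {A : Matrix d d ℂ} :
    A ∈ lieCommutant V ↔ Commute V (lieTwo A) := Iff.rfl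

lemma commutator_mem_lieCommutant {V : Matrix (Fin 2 → d) (Fin 2 → d) ℂ} {A B : Matrix d d ℂ}
    (hA : A ∈ lieCommutant V) (hB : B ∈ lieCommutant V) : A * B - B * A ∈ lieCommutant V := by
  rw [mem_lieCommutant] at *
  rw [lieTwo_commutator]
  exact (hA.mul_right hB).sub_right (hB.mul_right hA)

lemma one_mem_lieCommutant (V : Matrix (Fin 2 → d) (Fin 2 → d) ℂ) : 1 ∈ lieCommutant V := by
  have h : lieTwo (1 : Matrix d d ℂ) = (2 : ℂ) • 1 := by
    have h1 : ![(1 : Matrix d d ℂ), 1] = 1 := by funext i; fin_cases i <;> rfl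
    rw [lieTwo, h1, tensor_one]
    module
  rw [mem_lieCommutant, h]
  exact (Commute.one_right V).smul_right _

omit [DecidableEq d] in
lemma tpow_two_eq (U : Matrix d d ℂ) : tpow 2 U = tensor ![U, U] := by
  rw [tpow_eq_tensor]
  congr 1
  funext i
  fin_cases i <;> rfl

lemma commute_tpow_two {V : Matrix (Fin 2 → d) (Fin 2 → d) ℂ}
    (h : ∀ A, A ∈ lieCommutant V) (U : Matrix d d ℂ) : Commute V (tpow 2 U) := by
  have hU : tpow 2 U = (2⁻¹ : ℂ) • (lieTwo U * lieTwo U - lieTwo (U * U)) := by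
    rw [lieTwo_mul, tpow_two_eq]
    module
  rw [hU]
  exact (((h U).mul_right (h U)).sub_right (h (U * U))).smul_right _

lemma tpow_two_smul_one_add_smul (c s : ℂ) (A : Matrix d d ℂ) :
    tpow 2 (c • 1 + s • A) = c ^ 2 • 1 + (c * s) • lieTwo A + s ^ 2 • tensor ![A, A] := by
  have h1 : (1 : Matrix (Fin 2 → d) (Fin 2 → d) ℂ) = tensor ![1, 1] := by
    rw [← tensor_one]
    congr 1
    funext i
    fin_cases i <;> rfl
  ext x y
  simp only [h1, tpow_two_eq, lieTwo, Matrix.add_apply, Matrix.smul_apply, tensor_pair_apply, smul_eq_mul]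
  ring

/-- Vectors fixed by `U^{⊗2,2}` correspond to operators commuting with `U^{⊗2}`. -/
lemma tpow2_mulVec_eq_self_iff (t : ℕ) {U : Matrix d d ℂ} (hU : U ∈ unitaryGroup d ℂ)
    (v : (Fin t → d) × (Fin t → d) → ℂ) :
    tpow2 t U *ᵥ v = v ↔ Commute (Matrix.of fun a b => v (a, b)) (tpow t U) := by
  have h1 : (tpow t U)ᴴ * tpow t U = 1 := by
    rw [← tpow_conjTranspose, ← tpow_mul, ← star_eq_conjTranspose, mem_unitaryGroup_iff'.mp hU]
    exact tensor_one
  have h2 : tpow t U * (tpow t U)ᴴ = 1 := mul_eq_one_comm.mp h1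
  set V : Matrix (Fin t → d) (Fin t → d) ℂ := Matrix.of fun a b => v (a, b) with hV
  have hiff : tpow2 t U *ᵥ v = v ↔ tpow t U * V * (tpow t U)ᴴ = V := by
    constructor
    · intro h
      ext a b
      rw [← tpow2_mulVec, h, hV, of_apply]
    · intro h
      funext ⟨a, b⟩
      rw [tpow2_mulVec, ← hV, h, hV, of_apply]
  rw [hiff, commute_iff_eq]
  constructor
  · intro h
    conv_lhs => rw [← h]
    rw [mul_assoc, h1, mul_one]
  · intro h
    rw [← h, mul_assoc, h2, mul_one]

end TwoCopies

/-! ### The gates `e^{iφA}` for a self-adjoint involution `A` -/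

section Rotation

variable {n : ℕ} {A B : QMat n}

lemma rotGate_eq (hA : A * A = 1) (φ : ℝ) :
    rotGate φ A = (Real.cos φ : ℂ) • 1 + (Complex.I * Real.sin φ) • A := by
  have hev : ∀ k, A ^ (2 * k) = 1 := fun k => by rw [pow_mul, pow_two, hA, one_pow]
  have hodd : ∀ k, A ^ (2 * k + 1) = A := fun k => by rw [pow_succ, hev, one_mul]
  have hc := (Complex.hasSum_cos' φ).smul_const (1 : QMat n)
  have hs := ((Complex.hasSum_sin' φ).mul_left Complex.I).smul_const A
  rw [rotGate, mexp]
  refine (HasSum.even_add_odd ?_ ?_).tsum_eq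
  · rw [Complex.ofReal_cos]
    convert hc using 2 with k
    rw [smul_pow, hev, smul_smul, mul_comm Complex.I, div_eq_inv_mul]
  · rw [Complex.ofReal_sin]
    convert hs using 2 with k
    rw [smul_pow, hodd, smul_smul, mul_comm Complex.I]
    congr 1
    field_simp

lemma rotGate_add (hA : A * A = 1) (φ θ : ℝ) :
    rotGate (φ + θ) A = rotGate φ A * rotGate θ A := by
  simp only [rotGate_eq hA, add_mul, mul_add, smul_mul_smul_comm, hA, one_mul, mul_one,
    Real.cos_add, Real.sin_add]
  push_cast
  have hI : Complex.I * Real.sin φ * (Complex.I * Real.sin θ) = -(Real.sin φ * Real.sin θ) := by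
    linear_combination (Real.sin φ * Real.sin θ : ℂ) * Complex.I_mul_I
  push_cast at hI
  rw [hI]
  module

lemma rotGate_conjTranspose (hA : A * A = 1) (hA' : Aᴴ = A) (φ : ℝ) :
    (rotGate φ A)ᴴ = rotGate (-φ) A := by
  rw [rotGate_eq hA, rotGate_eq hA]
  simp [hA', conjTranspose_add, conjTranspose_smul, -Complex.ofReal_cos, -Complex.ofReal_sin]

lemma rotGate_zero (hA : A * A = 1) : rotGate 0 A = 1 := by
  simp [rotGate_eq hA]

lemma rotGate_mem_unitaryGroup (hA : A * A = 1) (hA' : Aᴴ = A) (φ : ℝ) :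
    rotGate φ A ∈ unitaryGroup (Fin n → Fin 2) ℂ := by
  rw [mem_unitaryGroup_iff, star_eq_conjTranspose, rotGate_conjTranspose hA hA',
    ← rotGate_add hA, add_neg_cancel, rotGate_zero hA]

lemma rotGate_periodic (hA : A * A = 1) : Function.Periodic (fun φ => rotGate φ A) (2 * π) := by
  intro φ
  simp [rotGate_eq hA]

lemma continuous_rotGate_apply (hA : A * A = 1) (x y : Fin n → Fin 2) :
    Continuous fun φ => rotGate φ A x y := by
  simp only [rotGate_eq hA, Matrix.add_apply, Matrix.smul_apply, smul_eq_mul]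
  fun_prop

lemma rotGate_commute (hA : A * A = 1) (hB : B * B = 1) (h : Commute A B) (φ θ : ℝ) :
    Commute (rotGate φ A) (rotGate θ B) := by
  rw [rotGate_eq hA, rotGate_eq hB]
  exact (((Commute.one_left _).smul_left _).add_left
    ((((Commute.one_right _).smul_right _).add_right (h.smul_right _)).smul_left _))

/-- An operator commuting with all `(e^{iφA})^{⊗2}` commutes with `A ⊗ 1 + 1 ⊗ A`. -/
lemma mem_lieCommutant_of_commute_rotGate (hA : A * A = 1)
    {V : Matrix (Fin 2 → Fin n → Fin 2) (Fin 2 → Fin n → Fin 2) ℂ}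
    (h : ∀ φ, Commute V (tpow 2 (rotGate φ A))) : A ∈ lieCommutant V := by
  have h1 := (h (π / 4)).sub_right (h (-(π / 4)))
  have hval : tpow 2 (rotGate (π / 4) A) - tpow 2 (rotGate (-(π / 4)) A) =
      Complex.I • lieTwo A := by
    rw [rotGate_eq hA, rotGate_eq hA, tpow_two_smul_one_add_smul, tpow_two_smul_one_add_smul,
      Real.cos_neg, Real.sin_neg, Real.cos_pi_div_four, Real.sin_pi_div_four]
    have h2 : ((Real.sqrt 2 / 2 : ℝ) : ℂ) * ((Real.sqrt 2 / 2 : ℝ) : ℂ) = 1 / 2 := by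
      rw [← Complex.ofReal_mul, div_mul_div_comm, Real.mul_self_sqrt (by norm_num)]
      norm_num
    set r : ℂ := ((Real.sqrt 2 / 2 : ℝ) : ℂ)
    rw [show ((-(Real.sqrt 2 / 2) : ℝ) : ℂ) = -r by simp [r],
      show r * (Complex.I * r) = Complex.I / 2 by linear_combination Complex.I * h2,
      show r * (Complex.I * -r) = -(Complex.I / 2) by linear_combination -Complex.I * h2]
    module
  rw [hval] at h1
  have h3 := h1.smul_right (-Complex.I)
  rwa [smul_smul, neg_mul, Complex.I_mul_I, neg_neg, one_smul] at h3

end Rotation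

/-! ### Averages of matrix-valued functions -/

section Average

variable {Ω m : Type*} [MeasurableSpace Ω] [Fintype m] {ν : Measure Ω} {R : Ω → Matrix m m ℂ}

/-- The entrywise average of a matrix-valued function. -/
def matAvg (ν : Measure Ω) (R : Ω → Matrix m m ℂ) : Matrix m m ℂ :=
  Matrix.of fun x y => ∫ ω, R ω x y ∂ν

omit [Fintype m] in
lemma matAvg_congr {R' : Ω → Matrix m m ℂ} (h : ∀ ω, R ω = R' ω) : matAvg ν R = matAvg ν R' := by
  rw [funext h]

omit [Fintype m] in
lemma matAvg_const [IsProbabilityMeasure ν] (A : Matrix m m ℂ) : matAvg ν (fun _ => A) = A := by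
  ext x y
  simp [matAvg]

lemma mul_matAvg (hR : ∀ x y, Integrable (fun ω => R ω x y) ν) (A : Matrix m m ℂ) :
    A * matAvg ν R = matAvg ν fun ω => A * R ω := by
  ext x y
  simp only [matAvg, mul_apply, of_apply]
  rw [integral_finsetSum _ fun z _ => (hR z y).const_mul _]
  exact Finset.sum_congr rfl fun z _ => (integral_const_mul _ _).symm

lemma matAvg_mul (hR : ∀ x y, Integrable (fun ω => R ω x y) ν) (A : Matrix m m ℂ) :
    matAvg ν R * A = matAvg ν fun ω => R ω * A := by
  ext x y
  simp only [matAvg, mul_apply, of_apply]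
  rw [integral_finsetSum _ fun z _ => (hR x z).mul_const _]
  exact Finset.sum_congr rfl fun z _ => (integral_mul_const _ _).symm

lemma matAvg_mulVec_eq_self [IsProbabilityMeasure ν]
    (hR : ∀ x y, Integrable (fun ω => R ω x y) ν) {v : m → ℂ} (hv : ∀ ω, R ω *ᵥ v = v) :
    matAvg ν R *ᵥ v = v := by
  funext x
  simp only [matAvg, mulVec, dotProduct, of_apply]
  have : ∀ y, (∫ ω, R ω x y ∂ν) * v y = ∫ ω, R ω x y * v y ∂ν := fun y =>
    (integral_mul_const _ _).symm
  simp_rw [this]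
  rw [← integral_finsetSum _ fun y _ => (hR x y).mul_const _]
  have h2 : ∀ ω, ∑ y, R ω x y * v y = v x := fun ω => congrFun (hv ω) x
  simp [h2]

/-- If `R(ω)` commutes with `A` for all `ω`, so does the average. -/
lemma commute_matAvg (hR : ∀ x y, Integrable (fun ω => R ω x y) ν) {A : Matrix m m ℂ}
    (h : ∀ ω, Commute A (R ω)) : Commute A (matAvg ν R) := by
  rw [commute_iff_eq, mul_matAvg hR, matAvg_mul hR]
  exact matAvg_congr fun ω => h ω

/-- An average which is invariant under all `R(ω)ᴴ` is an orthogonal projection. -/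
lemma isStarProjection_matAvg [IsProbabilityMeasure ν]
    (hR : ∀ x y, Integrable (fun ω => R ω x y) ν)
    (hinv : ∀ ω, (R ω)ᴴ * matAvg ν R = matAvg ν R) : IsStarProjection (matAvg ν R) := by
  have h : (matAvg ν R)ᴴ * matAvg ν R = (matAvg ν R)ᴴ := by
    conv_lhs => rw [mul_matAvg hR]
    rw [matAvg_congr (R' := fun _ => (matAvg ν R)ᴴ) fun ω => ?_, matAvg_const]
    rw [← conjTranspose_conjTranspose (R ω), ← conjTranspose_mul, hinv]
  have hH := congrArg conjTranspose h
  rw [conjTranspose_mul, conjTranspose_conjTranspose, h] at hH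
  exact ⟨by rw [hH] at h; exact h, hH⟩

end Average

/-! ### Uniformly random angles -/

/-- The uniform probability measure on `[0, 2π)`. -/
def angleMeasure : Measure ℝ :=
  (ENNReal.ofReal (2 * π))⁻¹ • volume.restrict (Set.Ico 0 (2 * π))

instance : IsProbabilityMeasure angleMeasure := by
  constructor
  rw [angleMeasure, Measure.smul_apply, Measure.restrict_apply_univ, Real.volume_Ico, sub_zero,
    smul_eq_mul]
  exact ENNReal.inv_mul_cancel (by simp [Real.pi_pos]) ENNReal.ofReal_ne_top

lemma unifBox_eq_pi (ι : Type*) [Fintype ι] :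
    unifBox ι = Measure.pi fun _ : ι => angleMeasure := by
  symm
  refine Measure.pi_eq fun s hs => ?_
  rw [unifBox, volume_pi, Measure.restrict_pi_pi, Measure.smul_apply, Measure.pi_pi]
  simp only [angleMeasure, Measure.smul_apply, smul_eq_mul, Finset.prod_mul_distrib,
    Finset.prod_const, Finset.card_univ]
  rw [ENNReal.ofReal_pow (by positivity), ENNReal.inv_pow]

lemma integral_angleMeasure (f : ℝ → ℂ) :
    ∫ φ, f φ ∂angleMeasure = ((2 * π : ℝ) : ℂ)⁻¹ * ∫ φ in (0 : ℝ)..(2 * π), f φ := by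
  rw [angleMeasure, integral_smul_measure, intervalIntegral.integral_of_le Real.two_pi_pos.le,
    ← integral_Ico_eq_integral_Ioc, ENNReal.toReal_inv, ENNReal.toReal_ofReal Real.two_pi_pos.le,
    Complex.real_smul, Complex.ofReal_inv]

lemma integrable_angleMeasure {f : ℝ → ℂ} (hf : Continuous f) : Integrable f angleMeasure := by
  refine Integrable.smul_measure ?_ (by simp [Real.pi_pos])
  exact (hf.continuousOn.integrableOn_compact isCompact_Icc).mono_set Set.Ico_subset_Icc_self

lemma integrable_unifBox {ι : Type*} [Fintype ι] {f : (ι → ℝ) → ℂ} (hf : Continuous f) :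
    Integrable f (unifBox ι) := by
  refine Integrable.smul_measure ?_ ?_
  · refine (hf.continuousOn.integrableOn_compact
      (isCompact_univ_pi fun _ : ι => isCompact_Icc (a := (0 : ℝ)) (b := 2 * π))).mono_set ?_
    exact Set.pi_mono fun i _ => Set.Ico_subset_Icc_self
  · simp [Real.pi_pos]

lemma integral_angleMeasure_add {f : ℝ → ℂ} (hf : Function.Periodic f (2 * π)) (θ : ℝ) :
    ∫ φ, f (θ + φ) ∂angleMeasure = ∫ φ, f φ ∂angleMeasure := by
  rw [integral_angleMeasure, integral_angleMeasure, intervalIntegral.integral_comp_add_left]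
  congr 1
  simpa using hf.intervalIntegral_add_eq θ 0

lemma continuous_list_prod_apply {X m : Type*} [TopologicalSpace X] [Fintype m] [DecidableEq m]
    {ι : Type*} (F : ι → X → Matrix m m ℂ) (l : List ι)
    (hF : ∀ i x y, Continuous fun φ => F i φ x y) (x y : m) :
    Continuous fun φ => (l.map fun i => F i φ).prod x y := by
  induction l generalizing x with
  | nil => simpa using continuous_const
  | cons i l ih =>
    simp only [List.map_cons, List.prod_cons, mul_apply]
    exact continuous_finsetSum _ fun z _ => (hF i x z).mul (ih z)

/-- The average of a product of matrices depending on distinct independent angles is the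
product of the averages. -/
lemma matAvg_list_prod {ι m : Type*} [Fintype ι] [Fintype m] [DecidableEq m]
    (F : ι → ℝ → Matrix m m ℂ) (hF : ∀ i x y, Continuous fun φ => F i φ x y)
    (l : List ι) (hl : l.Nodup) :
    matAvg (unifBox ι) (fun φ => (l.map fun i => F i (φ i)).prod) =
      (l.map fun i => matAvg angleMeasure (F i)).prod := by
  classical
  have key : ∀ (l : List ι), l.Nodup → ∀ (g : ι → ℝ → ℂ), (∀ i, Continuous (g i)) →
      (∀ i ∈ l, g i = 1) → ∀ x y,
      ∫ φ, (l.map fun i => F i (φ i)).prod x y * ∏ i, g i (φ i) ∂(unifBox ι) =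
        (l.map fun i => matAvg angleMeasure (F i)).prod x y * ∏ i, ∫ φ, g i φ ∂angleMeasure := by
    intro l
    induction l with
    | nil =>
      intro _ g _ _ x y
      simp only [List.map_nil, List.prod_nil]
      rw [integral_const_mul, unifBox_eq_pi, integral_fintype_prod_eq_prod]
    | cons j l ih =>
      intro hl g hg hg1 x y
      rw [List.nodup_cons] at hl
      simp only [List.map_cons, List.prod_cons, mul_apply, Finset.sum_mul]
      rw [integral_finsetSum]
      · refine Finset.sum_congr rfl fun z _ => ?_
        have h := ih hl.2 (Function.update g j fun φ => F j φ x z) (fun i => ?_) (fun i hi => ?_) z y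
        · rw [← Finset.mul_prod_erase univ (fun i => ∫ φ, Function.update g j _ i φ ∂angleMeasure)
            (mem_univ j)] at h
          have h2 : ∏ i ∈ univ.erase j, ∫ φ, Function.update g j (fun φ => F j φ x z) i φ
              ∂angleMeasure = ∏ i, ∫ φ, g i φ ∂angleMeasure := by
            rw [← Finset.mul_prod_erase univ (fun i => ∫ φ, g i φ ∂angleMeasure) (mem_univ j),
              hg1 j (by simp)]
            simp only [Pi.one_apply, integral_const, probReal_univ, one_smul, one_mul]
            refine Finset.prod_congr rfl fun i hi => ?_
            rw [Function.update_of_ne (Finset.ne_of_mem_erase hi)]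
          rw [h2, Function.update_self] at h
          refine Eq.trans ?_ (h.trans (?_ : _ = (∫ φ, F j φ x z ∂angleMeasure) * _ * _))
          swap
          · ring
          refine integral_congr_ae (ae_of_all _ fun φ => ?_)
          have h3 : ∏ i, Function.update g j (fun φ => F j φ x z) i (φ i) =
              F j (φ j) x z * ∏ i, g i (φ i) := by
            rw [← Finset.mul_prod_erase univ _ (mem_univ j),
              ← Finset.mul_prod_erase univ (fun i => g i (φ i)) (mem_univ j), hg1 j (by simp),
              Function.update_self]
            simp only [Pi.one_apply, one_mul]
            congr 1
            refine Finset.prod_congr rfl fun i hi => ?_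
            rw [Function.update_of_ne (Finset.ne_of_mem_erase hi)]
          simp only [h3]
          ring
        · rw [Function.update_apply]
          split_ifs
          · exact hF j x z
          · exact hg i
        · rw [Function.update_of_ne (fun h : i = j => hl.1 (h ▸ hi))]
          exact hg1 i (by simp [hi])
      · intro z _
        refine integrable_unifBox ((Continuous.mul ?_ ?_).mul ?_)
        · exact (hF j x z).comp (continuous_apply j)
        · exact continuous_list_prod_apply (fun i (φ : ι → ℝ) => F i (φ i)) l
            (fun i x y => (hF i x y).comp (continuous_apply i)) z y
        · exact continuous_finsetProd _ fun i _ => (hg i).comp (continuous_apply i)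
  ext x y
  have h := key l hl 1 (fun _ => continuous_const) (fun _ _ => rfl) x y
  simpa [matAvg] using h

/-! ### The projections `P_A` -/

section Projection

variable {n : ℕ} {A B : QMat n}

lemma continuous_tpow2_apply {X d : Type*} [TopologicalSpace X] [Fintype d]
    {U : X → Matrix d d ℂ} (hU : ∀ x y, Continuous fun φ => U φ x y) (t : ℕ)
    (x y : (Fin t → d) × (Fin t → d)) : Continuous fun φ => tpow2 t (U φ) x y := by
  simp only [tpow2, of_apply]
  exact (continuous_finsetProd _ fun i _ => hU _ _).mul
    (continuous_finsetProd _ fun i _ => Complex.continuous_conj.comp (hU _ _))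

lemma continuous_tpow2_rotGate (hA : A * A = 1) (x y) :
    Continuous fun φ => tpow2 2 (rotGate φ A) x y :=
  continuous_tpow2_apply (continuous_rotGate_apply hA) 2 x y

lemma Pproj_eq_matAvg (A : QMat n) :
    Pproj A = matAvg angleMeasure fun φ => tpow2 2 (rotGate φ A) := by
  ext x y
  simp only [Pproj, matAvg, of_apply, integral_angleMeasure]

lemma tpow2_rotGate_mul_Pproj (hA : A * A = 1) (θ : ℝ) :
    tpow2 2 (rotGate θ A) * Pproj A = Pproj A := by
  rw [Pproj_eq_matAvg, mul_matAvg fun x y => integrable_angleMeasure (continuous_tpow2_rotGate hA x y)]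
  ext x y
  simp only [matAvg, of_apply, ← tpow2_mul, ← rotGate_add hA]
  refine integral_angleMeasure_add (f := fun φ => tpow2 2 (rotGate φ A) x y) (fun φ => ?_) θ
  have h := rotGate_periodic hA φ
  simp only at h
  simp only [h]

lemma isStarProjection_Pproj (hA : A * A = 1) (hA' : Aᴴ = A) : IsStarProjection (Pproj A) := by
  rw [Pproj_eq_matAvg]
  refine isStarProjection_matAvg
    (fun x y => integrable_angleMeasure (continuous_tpow2_rotGate hA x y)) fun φ => ?_
  rw [← Pproj_eq_matAvg, ← tpow2_conjTranspose, rotGate_conjTranspose hA hA',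
    tpow2_rotGate_mul_Pproj hA]

lemma Pproj_mul_eq_of_forall (hA : A * A = 1)
    {E : Matrix ((Fin 2 → (Fin n → Fin 2)) × (Fin 2 → (Fin n → Fin 2)))
      ((Fin 2 → (Fin n → Fin 2)) × (Fin 2 → (Fin n → Fin 2))) ℂ}
    (hE : ∀ φ, tpow2 2 (rotGate φ A) * E = E) : Pproj A * E = E := by
  rw [Pproj_eq_matAvg,
    matAvg_mul fun x y => integrable_angleMeasure (continuous_tpow2_rotGate hA x y),
    matAvg_congr hE, matAvg_const]

lemma Pproj_commute (hA : A * A = 1) (hB : B * B = 1) (h : Commute A B) :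
    Commute (Pproj A) (Pproj B) := by
  rw [Pproj_eq_matAvg B]
  refine commute_matAvg
    (fun x y => integrable_angleMeasure (continuous_tpow2_rotGate hB x y)) fun φ => ?_
  rw [Pproj_eq_matAvg A]
  refine (commute_matAvg
    (fun x y => integrable_angleMeasure (continuous_tpow2_rotGate hA x y)) fun θ => ?_).symm
  rw [commute_iff_eq, ← tpow2_mul, ← tpow2_mul, (rotGate_commute hB hA h.symm φ θ).eq]

end Projection

/-! ### The Haar average -/

section Haar

variable {d : Type*} [Fintype d] [DecidableEq d]

lemma measurable_unitaryGroup_apply (x y : d) :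
    Measurable fun U : unitaryGroup d ℂ => (U : Matrix d d ℂ) x y := by
  have h : Measurable fun A : d → d → ℂ => A x y :=
    (measurable_pi_apply y).comp (measurable_pi_apply x)
  exact h.comp measurable_subtype_coe

lemma measurable_unitaryGroup_mul_left (g : unitaryGroup d ℂ) :
    Measurable fun U : unitaryGroup d ℂ => g * U := by
  refine Measurable.subtype_mk ?_
  refine measurable_pi_lambda _ fun x => measurable_pi_lambda _ fun y => ?_
  change Measurable fun U : unitaryGroup d ℂ => ((g : Matrix d d ℂ) * (U : Matrix d d ℂ)) x y
  simp only [mul_apply]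
  exact Finset.measurable_sum _ fun z _ =>
    (measurable_unitaryGroup_apply z y).const_mul _

lemma measurable_tpow2_unitaryGroup (t : ℕ) (x y) :
    Measurable fun U : unitaryGroup d ℂ => tpow2 t (U : Matrix d d ℂ) x y := by
  simp only [tpow2, of_apply]
  refine (Finset.measurable_prod _ fun i _ => measurable_unitaryGroup_apply _ _).mul
    (Finset.measurable_prod _ fun i _ => ?_)
  exact Complex.continuous_conj.measurable.comp (measurable_unitaryGroup_apply _ _)

variable (μ : Measure (unitaryGroup d ℂ))

lemma integrable_tpow2_unitaryGroup [IsFiniteMeasure μ] (t : ℕ) (x y) :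
    Integrable (fun U : unitaryGroup d ℂ => tpow2 t (U : Matrix d d ℂ) x y) μ := by
  refine Integrable.of_bound (measurable_tpow2_unitaryGroup t x y).aestronglyMeasurable 1
    (ae_of_all _ fun U => ?_)
  simp only [tpow2, of_apply, norm_mul, norm_prod, RCLike.norm_conj]
  exact mul_le_one₀
    (Finset.prod_le_one (fun _ _ => norm_nonneg _) fun _ _ => entry_norm_bound_of_unitary U.2 _ _)
    (Finset.prod_nonneg fun _ _ => norm_nonneg _)
    (Finset.prod_le_one (fun _ _ => norm_nonneg _) fun _ _ => entry_norm_bound_of_unitary U.2 _ _)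

lemma Mmat_eq_matAvg (t : ℕ) :
    Mmat μ t = matAvg μ fun U => tpow2 t (U : Matrix d d ℂ) := rfl

variable [IsProbabilityMeasure μ] [μ.IsMulLeftInvariant]

lemma tpow2_mul_Mmat (t : ℕ) (g : unitaryGroup d ℂ) :
    tpow2 t (g : Matrix d d ℂ) * Mmat μ t = Mmat μ t := by
  rw [Mmat_eq_matAvg, mul_matAvg (integrable_tpow2_unitaryGroup μ t)]
  ext x y
  simp only [matAvg, of_apply]
  have hmap : μ.map (fun U => g * U) = μ := map_mul_left_eq_self μ g
  conv_rhs => rw [← hmap]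
  rw [integral_map (measurable_unitaryGroup_mul_left g).aemeasurable
    (measurable_tpow2_unitaryGroup t x y).aestronglyMeasurable]
  simp only [UnitaryGroup.mul_val, tpow2_mul]

lemma isStarProjection_Mmat (t : ℕ) : IsStarProjection (Mmat μ t) := by
  rw [Mmat_eq_matAvg]
  refine isStarProjection_matAvg (integrable_tpow2_unitaryGroup μ t) fun U => ?_
  rw [← tpow2_conjTranspose]
  exact tpow2_mul_Mmat μ t (star U)

end Haar

/-! ### The gates of the circuit -/

section Gates

variable {n : ℕ}

/-- The generators in the order in which they occur in the circuit. -/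
def gen (p : Fin 3 × Fin n) : QMat n :=
  ![ZXZop, Zop, Xop] p.1 p.2

/-- The local factors of the generators. -/
def genFactor (p : Fin 3 × Fin n) : Fin n → Matrix (Fin 2) (Fin 2) ℂ :=
  ![zxzFactor, fun i => Function.update 1 i pauliZ, fun i => Function.update 1 i pauliX] p.1 p.2

lemma gen_eq_tensor (p : Fin 3 × Fin n) : gen p = tensor (genFactor p) := by
  obtain ⟨a, i⟩ := p
  fin_cases a
  · exact ZXZop_eq_tensor i
  · exact op1_eq_tensor i _
  · exact op1_eq_tensor i _

lemma genFactor_cases (p : Fin 3 × Fin n) (k : Fin n) :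
    genFactor p k = 1 ∨ genFactor p k = pauliX ∨ genFactor p k = pauliZ := by
  obtain ⟨a, i⟩ := p
  fin_cases a
  · change zxzFactor i k = 1 ∨ zxzFactor i k = pauliX ∨ zxzFactor i k = pauliZ
    unfold zxzFactor
    split_ifs <;> simp
  · by_cases h : k = i
    · subst h; simp [genFactor]
    · simp [genFactor, h]
  · by_cases h : k = i
    · subst h; simp [genFactor]
    · simp [genFactor, h]

lemma gen_mul_self (p : Fin 3 × Fin n) : gen p * gen p = 1 := by
  rw [gen_eq_tensor, tensor_mul, ← tensor_one]
  congr 1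
  funext k
  rcases genFactor_cases p k with h | h | h <;>
    simp [h, pauliX_mul_self, pauliZ_mul_self]

lemma gen_conjTranspose (p : Fin 3 × Fin n) : (gen p)ᴴ = gen p := by
  rw [gen_eq_tensor, tensor_conjTranspose]
  congr 1
  funext k
  rcases genFactor_cases p k with h | h | h <;>
    simp [h, pauliX_conjTranspose, pauliZ_conjTranspose]

/-- The pairs of generators which need not commute. -/
def gateRel (p q : Fin 3 × Fin n) : Prop :=
  p.1 ≠ q.1 ∧ if p.1 = 1 ∨ q.1 = 1 then p.2 = q.2
    else (p.2 : ℕ) + 1 = q.2 ∨ (q.2 : ℕ) + 1 = p.2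

lemma tensor_commute {M N : Fin n → Matrix (Fin 2) (Fin 2) ℂ}
    (h : ∀ k, M k * N k = N k * M k) : Commute (tensor M) (tensor N) :=
  tensor_commute_of_prod_eq_one 1 (fun k => by simp [h k]) (by simp)

lemma ZXZop_commute (i j : Fin n) : Commute (ZXZop i) (ZXZop j) := by
  rw [ZXZop_eq_tensor, ZXZop_eq_tensor]
  by_cases hij : (i : ℕ) + 1 = j ∨ (j : ℕ) + 1 = i
  · have hne : i ≠ j := fun h => by subst h; omega
    refine tensor_commute_of_prod_eq_one
      (fun k => (if k = i then -1 else 1) * (if k = j then -1 else 1)) (fun k => ?_) ?_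
    · simp only [zxzFactor]
      split_ifs <;> first
        | (exfalso; simp only [Fin.ext_iff] at *; omega)
        | simp [pauliX_mul_pauliZ]
    · rw [Finset.prod_mul_distrib]
      simp
  · refine tensor_commute fun k => ?_
    simp only [zxzFactor]
    split_ifs <;> first
      | rfl
      | simp
      | (exfalso; simp only [Fin.ext_iff] at *; omega)

lemma gen_commute {p q : Fin 3 × Fin n} (h : ¬ gateRel p q) : Commute (gen p) (gen q) := by
  obtain ⟨a, i⟩ := p
  obtain ⟨b, j⟩ := q
  by_cases h0 : a = 0 ∧ b = 0
  · obtain ⟨rfl, rfl⟩ := h0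
    exact ZXZop_commute i j
  rw [gen_eq_tensor, gen_eq_tensor]
  refine tensor_commute fun k => ?_
  fin_cases a <;> fin_cases b <;>
    simp [gateRel, Fin.ext_iff] at h h0 <;>
    simp [genFactor, zxzFactor, Function.update_apply, Fin.ext_iff] <;>
    split_ifs <;> first | rfl | simp | omega

lemma gateRel_comm {p q : Fin 3 × Fin n} : gateRel p q ↔ gateRel q p := by
  simp only [gateRel, ne_comm (a := p.1), or_comm (a := p.1 = 1), eq_comm (a := p.2),
    or_comm (a := (p.2 : ℕ) + 1 = q.2)]

open Classical in
lemma card_gateRel_le (p : Fin 3 × Fin n) : #{q | gateRel p q} ≤ 3 := by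
  obtain ⟨a, i⟩ := p
  have key : ∀ s : Finset (Fin 3 × ℕ), #s ≤ 3 →
      (∀ q, gateRel (a, i) q → (q.1, (q.2 : ℕ)) ∈ s) → #{q | gateRel (a, i) q} ≤ 3 := by
    intro s hs h
    refine (Finset.card_le_card_of_injOn (fun q => (q.1, (q.2 : ℕ))) (fun q hq => ?_)
      (fun q _ q' _ hqq => ?_)).trans hs
    · exact h q (by simpa using hq)
    · simp only [Prod.mk.injEq] at hqq
      exact Prod.ext hqq.1 (Fin.ext hqq.2)
  fin_cases a
  · refine key {(1, (i : ℕ)), (2, (i : ℕ) - 1), (2, (i : ℕ) + 1)} card_le_three ?_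
    rintro ⟨b, j⟩ h
    fin_cases b <;> simp [gateRel, Fin.ext_iff] at h ⊢ <;> omega
  · refine key {(0, (i : ℕ)), (2, (i : ℕ)), (2, (i : ℕ))} card_le_three ?_
    rintro ⟨b, j⟩ h
    fin_cases b <;> simp [gateRel, Fin.ext_iff] at h ⊢ <;> omega
  · refine key {(1, (i : ℕ)), (0, (i : ℕ) - 1), (0, (i : ℕ) + 1)} card_le_three ?_
    rintro ⟨b, j⟩ h
    fin_cases b <;> simp [gateRel, Fin.ext_iff] at h ⊢ <;> omega

/-- A vector fixed by all the projections `P_A` is fixed by the Haar average. -/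
lemma Mmat_mulVec_eq_self (μ : Measure (unitaryGroup (Fin n → Fin 2) ℂ)) [IsProbabilityMeasure μ]
    {v : (Fin 2 → (Fin n → Fin 2)) × (Fin 2 → (Fin n → Fin 2)) → ℂ}
    (hv : ∀ p : Fin 3 × Fin n, Pproj (gen p) *ᵥ v = v) : Mmat μ 2 *ᵥ v = v := by
  have hgen : ∀ p : Fin 3 × Fin n, gen p ∈ lieCommutant (Matrix.of fun a b => v (a, b)) := by
    intro p
    refine mem_lieCommutant_of_commute_rotGate (gen_mul_self p) fun φ => ?_
    rw [← tpow2_mulVec_eq_self_iff 2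
      (rotGate_mem_unitaryGroup (gen_mul_self p) (gen_conjTranspose p) φ)]
    conv_lhs => rw [← hv p]
    rw [mulVec_mulVec, tpow2_rotGate_mul_Pproj (gen_mul_self p), hv p]
  have hall := mem_of_generators (fun _ _ => commutator_mem_lieCommutant)
    (one_mem_lieCommutant _) (fun i => hgen (2, i)) (fun i => hgen (1, i)) (fun i => hgen (0, i))
  refine matAvg_mulVec_eq_self (integrable_tpow2_unitaryGroup μ 2) fun U => ?_
  rw [tpow2_mulVec_eq_self_iff 2 U.2]
  exact commute_tpow_two hall U

end Gates

/-! ### The detectability lemma -/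

section Detectability

variable {V : Type*} [NormedAddCommGroup V] [InnerProductSpace ℂ V] [CompleteSpace V]

lemma IsStarProjection.inner_apply_left {P : V →L[ℂ] V} (hP : IsStarProjection P) (x y : V) :
    inner ℂ (P x) y = inner ℂ x (P y) :=
  hP.isSelfAdjoint.isSymmetric x y

lemma IsStarProjection.apply_apply {P : V →L[ℂ] V} (hP : IsStarProjection P) (x : V) :
    P (P x) = P x := congrArg (fun T : V →L[ℂ] V => T x) hP.isIdempotentElem

lemma IsStarProjection.inner_sub_apply {P : V →L[ℂ] V} (hP : IsStarProjection P) (x : V) :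
    inner ℂ (x - P x) (x - P x) = inner ℂ x (x - P x) := by
  rw [inner_sub_left, hP.inner_apply_left, map_sub, hP.apply_apply, sub_self, inner_zero_right,
    sub_zero]

lemma IsStarProjection.re_inner_sub_apply {P : V →L[ℂ] V} (hP : IsStarProjection P) (x : V) :
    RCLike.re (inner ℂ x (x - P x)) = ‖x - P x‖ ^ 2 := by
  rw [← hP.inner_sub_apply, inner_self_eq_norm_sq]

lemma IsStarProjection.norm_sub_apply_sq {P : V →L[ℂ] V} (hP : IsStarProjection P) (x : V) :
    ‖x - P x‖ ^ 2 = ‖x‖ ^ 2 - ‖P x‖ ^ 2 := by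
  rw [← hP.re_inner_sub_apply, inner_sub_right, map_sub, inner_self_eq_norm_sq,
    ← inner_self_eq_norm_sq (𝕜 := ℂ) (P x), hP.inner_apply_left, hP.apply_apply]

lemma IsStarProjection.norm_apply_le {P : V →L[ℂ] V} (hP : IsStarProjection P) (x : V) :
    ‖P x‖ ≤ ‖x‖ := by
  have h := hP.norm_sub_apply_sq x
  exact (sq_le_sq₀ (norm_nonneg _) (norm_nonneg _)).mp (by nlinarith [sq_nonneg ‖x - P x‖])

variable {ι : Type*} [Fintype ι] {P : ι → V →L[ℂ] V} {r : ι → ι → Prop}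

open Classical in
/-- Each local excitation of `P₁ ⋯ Pₘ ψ` is controlled by the norm losses `aⱼ` at the
projections that do not commute with it. -/
lemma exists_norm_loss (hP : ∀ i, IsStarProjection (P i))
    (hr : ∀ i j, ¬ r i j → Commute (P i) (P j)) (ψ : V) (l : List ι) (hl : l.Nodup) :
    ∃ a : ι → ℝ, (∀ i, 0 ≤ a i) ∧ (∀ i ∉ l, a i = 0) ∧
      ∑ i, a i ^ 2 = ‖ψ‖ ^ 2 - ‖(l.map P).prod ψ‖ ^ 2 ∧
      ∀ i ∈ l, ‖(l.map P).prod ψ - P i ((l.map P).prod ψ)‖ ≤ ∑ j with r i j, a j := by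
  induction l with
  | nil => exact ⟨0, by simp, by simp, by simp, by simp⟩
  | cons j l ih =>
    rw [List.nodup_cons] at hl
    obtain ⟨a, ha0, hal, hsum, hbd⟩ := ih hl.2
    simp only [List.map_cons, List.prod_cons, mul_apply_eq_comp]
    set χ := (l.map P).prod ψ with hχ
    set x := ‖χ - P j χ‖ with hx
    have haj : a j = 0 := hal j hl.1
    refine ⟨fun i => a i + if i = j then x else 0, fun i => ?_, fun i hi => ?_, ?_, ?_⟩
    · change 0 ≤ a i + if i = j then x else 0
      split_ifs
      · exact add_nonneg (ha0 i) (norm_nonneg _)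
      · simpa using ha0 i
    · simp only [List.mem_cons, not_or] at hi
      simp [hi.1, hal i hi.2]
    · have : ∀ i, (a i + if i = j then x else 0) ^ 2 = a i ^ 2 + if i = j then x ^ 2 else 0 := by
        intro i
        split_ifs with h
        · subst h; simp [haj]
        · simp
      simp_rw [this]
      rw [Finset.sum_add_distrib, hsum, Finset.sum_ite_eq', if_pos (mem_univ j), hx,
        (hP j).norm_sub_apply_sq]
      ring
    · intro i hi
      have hsplit : ∑ k with r i k, (a k + if k = j then x else 0) =
          ∑ k with r i k, a k + if r i j then x else 0 := by
        rw [Finset.sum_add_distrib, Finset.sum_ite_eq']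
        simp
      rw [hsplit]
      by_cases hij : i = j
      · subst hij
        rw [(hP i).apply_apply, sub_self, norm_zero]
        refine add_nonneg (Finset.sum_nonneg fun k _ => ha0 k) ?_
        split_ifs
        · exact norm_nonneg _
        · exact le_rfl
      have hil : i ∈ l := (List.mem_cons.mp hi).resolve_left hij
      split_ifs with hrij
      · have heq : P j χ - P i (P j χ) = (χ - P i χ) - ((χ - P j χ) - P i (χ - P j χ)) := by
          simp only [map_sub]; abel
        have hle : ‖(χ - P j χ) - P i (χ - P j χ)‖ ≤ x := by
          have h := (hP i).norm_sub_apply_sq (χ - P j χ)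
          exact (sq_le_sq₀ (norm_nonneg _) (norm_nonneg _)).mp
            (by nlinarith [sq_nonneg ‖P i (χ - P j χ)‖])
        rw [heq]
        exact (norm_sub_le _ _).trans (add_le_add (hbd i hil) hle)
      · have hc : P i (P j χ) = P j (P i χ) :=
          congrArg (fun T : V →L[ℂ] V => T χ) (hr i j hrij).eq
        rw [hc, ← map_sub, add_zero]
        exact ((hP j).norm_apply_le _).trans (hbd i hil)

open Classical in
/-- The energy of `P₁ ⋯ Pₘ ψ` is bounded by the norm lost in applying the projections. -/
lemma sum_norm_sub_sq_le (hP : ∀ i, IsStarProjection (P i))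
    (hr : ∀ i j, ¬ r i j → Commute (P i) (P j)) (hsymm : ∀ i j, r i j ↔ r j i) (g : ℕ)
    (hg : ∀ i, #{j | r i j} ≤ g) (ψ : V) (l : List ι) (hl : l.Nodup) (hmem : ∀ i, i ∈ l) :
    ∑ i, ‖(l.map P).prod ψ - P i ((l.map P).prod ψ)‖ ^ 2 ≤
      (g : ℝ) ^ 2 * (‖ψ‖ ^ 2 - ‖(l.map P).prod ψ‖ ^ 2) := by
  obtain ⟨a, ha0, -, hsum, hbd⟩ := exists_norm_loss hP hr ψ l hl
  have h1 : ∀ i, ‖(l.map P).prod ψ - P i ((l.map P).prod ψ)‖ ^ 2 ≤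
      (g : ℝ) * ∑ j with r i j, a j ^ 2 := by
    intro i
    calc _ ≤ (∑ j with r i j, a j) ^ 2 := by gcongr; exact hbd i (hmem i)
      _ ≤ (#{j | r i j} : ℝ) * ∑ j with r i j, a j ^ 2 := sq_sum_le_card_mul_sum_sq
      _ ≤ _ := by
        gcongr
        exact hg i
  calc _ ≤ ∑ i, (g : ℝ) * ∑ j with r i j, a j ^ 2 := Finset.sum_le_sum fun i _ => h1 i
    _ = (g : ℝ) * ∑ j, (#{i | r j i} : ℝ) * a j ^ 2 := by
      rw [← Finset.mul_sum]
      simp_rw [Finset.sum_filter]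
      rw [Finset.sum_comm]
      congr 1
      refine Finset.sum_congr rfl fun j _ => ?_
      simp_rw [hsymm _ j]
      rw [← Finset.sum_filter, Finset.sum_const, nsmul_eq_mul]
    _ ≤ (g : ℝ) * ∑ j, (g : ℝ) * a j ^ 2 := by
      gcongr with j
      exact hg j
    _ = _ := by rw [← Finset.mul_sum, hsum]; ring

omit [Fintype ι] in
lemma prod_mul_eq_of_forall {M : Type*} [Monoid M] {P : ι → M} {E : M} (h : ∀ i, P i * E = E)
    (l : List ι) : (l.map P).prod * E = E := by
  induction l with
  | nil => simp
  | cons i l ih => rw [List.map_cons, List.prod_cons, mul_assoc, ih, h]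

omit [Fintype ι] in
lemma mul_prod_eq_of_forall {M : Type*} [Monoid M] {P : ι → M} {E : M} (h : ∀ i, E * P i = E)
    (l : List ι) : E * (l.map P).prod = E := by
  induction l with
  | nil => simp
  | cons i l ih => rw [List.map_cons, List.prod_cons, ← mul_assoc, h, ih]

open Classical in
/-- **Detectability lemma** for projections having a common invariant projection `E`. -/
theorem norm_prod_sub_le (hP : ∀ i, IsStarProjection (P i))
    (hr : ∀ i j, ¬ r i j → Commute (P i) (P j)) (hsymm : ∀ i j, r i j ↔ r j i) {g : ℕ}
    (hg0 : g ≠ 0) (hg : ∀ i, #{j | r i j} ≤ g) {E : V →L[ℂ] V} (hE : IsStarProjection E)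
    (hPE : ∀ i, P i * E = E) (l : List ι) (hl : l.Nodup) (hmem : ∀ i, i ∈ l) {Δ : ℝ} (hΔ : 0 ≤ Δ)
    (hgap : ∀ φ, E φ = 0 → Δ * ‖φ‖ ^ 2 ≤ ∑ i, ‖φ - P i φ‖ ^ 2) :
    ‖(l.map P).prod - E‖ ≤ (1 + Δ / (g : ℝ) ^ 2) ^ (-(1 / 2) : ℝ) := by
  have hEP : ∀ i, E * P i = E := fun i => by
    have h := congrArg star (hPE i)
    rwa [star_mul, hE.isSelfAdjoint.star_eq, (hP i).isSelfAdjoint.star_eq] at h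
  have hg2 : (0 : ℝ) < (g : ℝ) ^ 2 := by positivity
  have hpos : 0 < 1 + Δ / (g : ℝ) ^ 2 := by positivity
  refine ContinuousLinearMap.opNorm_le_bound _ (by positivity) fun x => ?_
  set M := (l.map P).prod with hM
  set ψ := x - E x with hψ
  have hEψ : E ψ = 0 := by rw [hψ, map_sub, hE.apply_apply, sub_self]
  have hMx : (M - E) x = M ψ := by
    have h : M (E x) = E x :=
      congrArg (fun T : V →L[ℂ] V => T x) (prod_mul_eq_of_forall hPE l)
    rw [hψ, map_sub, h, _root_.sub_apply]
  have hEM : E (M ψ) = 0 := by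
    have h : E (M ψ) = E ψ :=
      congrArg (fun T : V →L[ℂ] V => T ψ) (mul_prod_eq_of_forall hEP l)
    rw [h, hEψ]
  have h1 := (hgap _ hEM).trans (sum_norm_sub_sq_le hP hr hsymm g hg ψ l hl hmem)
  have hψx : ‖ψ‖ ^ 2 ≤ ‖x‖ ^ 2 := by
    rw [hψ, hE.norm_sub_apply_sq]
    linarith [sq_nonneg ‖E x‖]
  have h2 : (1 + Δ / (g : ℝ) ^ 2) * ‖M ψ‖ ^ 2 ≤ ‖x‖ ^ 2 := by
    refine le_trans ?_ hψx
    rw [← hM] at h1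
    rw [add_mul, one_mul, div_mul_eq_mul_div, ← le_sub_iff_add_le', div_le_iff₀ hg2]
    linarith
  rw [hMx]
  refine (sq_le_sq₀ (norm_nonneg _) (by positivity)).mp ?_
  rw [mul_pow, ← Real.rpow_natCast ((1 + Δ / (g : ℝ) ^ 2) ^ _), ← Real.rpow_mul hpos.le]
  norm_num
  rw [Real.rpow_neg_one, ← div_eq_inv_mul, le_div_iff₀ hpos]
  linarith

end Detectability

/-! ### The spectral gap -/

section SpectralGap

variable {d : Type*} [Fintype d] [DecidableEq d]

lemma specGap_nonneg (A : Matrix d d ℂ) : 0 ≤ specGap A :=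
  Real.sInf_nonneg fun _ hc => hc.1.le

/-- Variational characterisation of the spectral gap on the complement of the kernel. -/
lemma specGap_mul_norm_sq_le {H : Matrix d d ℂ} (hH : H.IsHermitian)
    (hpos : ∀ x : EuclideanSpace ℂ d,
      0 ≤ RCLike.re (inner ℂ x (toEuclideanCLM (𝕜 := ℂ) H x)))
    {φ : EuclideanSpace ℂ d}
    (hφ : ∀ b, toEuclideanCLM (𝕜 := ℂ) H b = 0 → inner ℂ b φ = 0) :
    specGap H * ‖φ‖ ^ 2 ≤ RCLike.re (inner ℂ φ (toEuclideanCLM (𝕜 := ℂ) H φ)) := by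
  set T := toEuclideanCLM (𝕜 := ℂ) H with hT
  set b := hH.eigenvectorBasis
  have hTb : ∀ i, T (b i) = (hH.eigenvalues i : ℂ) • b i := by
    intro i
    have h := hH.mulVec_eigenvectorBasis i
    refine WithLp.ofLp_injective 2 ?_
    rw [hT, ofLp_toEuclideanCLM, h]
    ext j
    simp [b]
  have hTsymm : ∀ x y, inner ℂ (T x) y = inner ℂ x (T y) := by
    have : IsSelfAdjoint T := by
      rw [IsSelfAdjoint, hT, ← map_star, star_eq_conjTranspose, hH.eq]
    exact this.isSymmetric
  have hcoef : ∀ i, inner ℂ (b i) (T φ) = (hH.eigenvalues i : ℂ) * inner ℂ (b i) φ := by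
    intro i
    rw [← hTsymm, hTb, inner_smul_left, Complex.conj_ofReal]
  have hnorm : ‖φ‖ ^ 2 = ∑ i, ‖inner ℂ (b i) φ‖ ^ 2 := (b.sum_sq_norm_inner_right φ).symm
  have hquad : RCLike.re (inner ℂ φ (T φ)) =
      ∑ i, hH.eigenvalues i * ‖inner ℂ (b i) φ‖ ^ 2 := by
    rw [← b.sum_inner_mul_inner φ (T φ), map_sum]
    refine Finset.sum_congr rfl fun i _ => ?_
    rw [hcoef, mul_left_comm, ← inner_conj_symm φ (b i), RCLike.conj_mul]
    norm_cast
    exact Complex.re_ofReal_mul _ _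
  rw [hnorm, hquad, Finset.mul_sum]
  refine Finset.sum_le_sum fun i _ => ?_
  by_cases h0 : hH.eigenvalues i = 0
  · have : T (b i) = 0 := by rw [hTb, h0]; simp
    simp [hφ _ this]
  · gcongr
    refine csInf_le ⟨0, fun c hc => hc.1.le⟩ ⟨lt_of_le_of_ne ?_ (Ne.symm h0), ?_⟩
    · have h := hpos (b i)
      rw [hTb, inner_smul_right, inner_self_eq_norm_sq_to_K, b.norm_eq_one] at h
      simpa using h
    · rw [hH.spectrum_eq_image_range]
      exact ⟨_, ⟨i, rfl⟩, rfl⟩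

end SpectralGap

/-! ### The circuit -/

section Circuit

variable {n : ℕ}

lemma list_prod_map_product {α β M : Type*} [Monoid M] (f : α × β → M) (l₁ : List α)
    (l₂ : List β) :
    ((l₁ ×ˢ l₂).map f).prod = (l₁.map fun a => (l₂.map fun b => f (a, b)).prod).prod := by
  induction l₁ with
  | nil => simp
  | cons a l ih => simp [List.product_cons, ih, Function.comp_def]

/-- The generators listed in the order in which they occur in the circuit. -/
def genList (n : ℕ) : List (Fin 3 × Fin n) := List.finRange 3 ×ˢ List.finRange n

lemma nodup_genList : (genList n).Nodup :=
  (List.nodup_finRange 3).product (List.nodup_finRange n)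

lemma mem_genList (p : Fin 3 × Fin n) : p ∈ genList n :=
  List.mem_product.mpr ⟨List.mem_finRange _, List.mem_finRange _⟩

lemma vnCircuit_eq_prod (φ : Fin 3 → Fin n → ℝ) :
    vnCircuit φ = ((genList n).map fun p => rotGate (φ p.1 p.2) (gen p)).prod := by
  rw [genList, list_prod_map_product]
  simp [vnCircuit, List.ofFn_eq_map, List.finRange_succ, gen, mul_assoc]

lemma MvnPowMat_eq_pow (n k : ℕ) :
    MvnPowMat n k = ((genList n).map fun p => Pproj (gen p)).prod ^ k := by
  have h1 : MvnPowMat n k = matAvg (unifBox (Fin k × (Fin 3 × Fin n))) fun φ =>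
      ((List.finRange k ×ˢ genList n).map fun q => tpow2 2 (rotGate (φ q) (gen q.2))).prod := by
    ext x y
    simp only [MvnPowMat, matAvg, of_apply]
    congr 1
    funext φ
    refine congrFun (congrFun (?_ : (_ : Matrix _ _ ℂ) = _) x) y
    rw [List.ofFn_eq_map, tpow2_list_prod, list_prod_map_product, List.map_map]
    refine congrArg (List.prod (α := Matrix _ _ ℂ)) (List.map_congr_left fun j _ => ?_)
    rw [Function.comp_apply, vnCircuit_eq_prod, tpow2_list_prod, List.map_map]
    rfl
  have h2 := matAvg_list_prod (ι := Fin k × (Fin 3 × Fin n))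
    (fun q φ => tpow2 2 (rotGate φ (gen q.2)))
    (fun q x y => continuous_tpow2_rotGate (A := gen q.2) (gen_mul_self q.2) x y)
    (List.finRange k ×ˢ genList n) ((List.nodup_finRange k).product nodup_genList)
  rw [h1, h2, list_prod_map_product]
  simp only [← Pproj_eq_matAvg]
  simp

lemma Hham_eq_sum (n : ℕ) : Hham n = ∑ p : Fin 3 × Fin n, (1 - Pproj (gen p)) := by
  rw [Fintype.sum_prod_type, Fin.sum_univ_three]
  simp only [Hham, gen]
  simp only [Matrix.cons_val]
  abel

end Circuit

lemma sub_pow_of_mul_eq {R : Type*} [Ring R] {M E : R} (hME : M * E = E) (hEM : E * M = E)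
    (hE : E * E = E) {k : ℕ} (hk : 1 ≤ k) : M ^ k - E = (M - E) ^ k := by
  induction k, hk using Nat.le_induction with
  | base => simp
  | succ k hk ih =>
    have hMk : ∀ j : ℕ, M ^ j * E = E := fun j => by
      induction j with
      | zero => simp
      | succ j ihj => rw [pow_succ, mul_assoc, hME, ihj]
    rw [pow_succ (M - E), ← ih, sub_mul, mul_sub, mul_sub, hMk, hEM, hE, ← pow_succ]
    abel

/-- **Convergence bound:** `g(v_n^{*k}, 2) ≤ (1 + Δ(H_n)/9)^{-k/2}`. -/
theorem tpe_power_bound (n k : ℕ) (hn : 2 ≤ n) (hk : 1 ≤ k)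
    (μ : Measure (Matrix.unitaryGroup (Fin n → Fin 2) ℂ))
    [IsProbabilityMeasure μ] [μ.IsMulLeftInvariant] :
    opNorm (MvnPowMat n k - Mmat μ 2) ≤
      (1 + specGap (Hham n) / 9) ^ (-(k : ℝ) / 2) := by
  classical
  set T := toEuclideanCLM (𝕜 := ℂ)
    (n := (Fin 2 → (Fin n → Fin 2)) × (Fin 2 → (Fin n → Fin 2))) with hT
  set E := T (Mmat μ 2) with hEdef
  set P : Fin 3 × Fin n → _ := fun p => T (Pproj (gen p)) with hPdef
  have hmap : ∀ A, IsStarProjection A → IsStarProjection (T A) := fun A hA => hA.map T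
  have hP : ∀ p, IsStarProjection (P p) := fun p =>
    hmap _ (isStarProjection_Pproj (gen_mul_self p) (gen_conjTranspose p))
  have hE : IsStarProjection E := hmap _ (isStarProjection_Mmat μ 2)
  have hPE : ∀ p, P p * E = E := fun p => by
    rw [hPdef, hEdef, ← map_mul, Pproj_mul_eq_of_forall (gen_mul_self p) fun φ =>
      tpow2_mul_Mmat μ 2 ⟨_, rotGate_mem_unitaryGroup (gen_mul_self p) (gen_conjTranspose p) φ⟩]
  have hEP : ∀ p, E * P p = E := fun p => by
    have h := congrArg star (hPE p)
    rwa [star_mul, hE.isSelfAdjoint.star_eq, (hP p).isSelfAdjoint.star_eq] at h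
  have hH : T (Hham n) = ∑ p, (1 - P p) := by
    simp only [Hham_eq_sum, map_sum, map_sub, map_one, hPdef]
  have hquad : ∀ x, RCLike.re (inner ℂ x (T (Hham n) x)) = ∑ p, ‖x - P p x‖ ^ 2 := fun x => by
    rw [hH, _root_.sum_apply, inner_sum, map_sum]
    exact Finset.sum_congr rfl fun p _ => (hP p).re_inner_sub_apply x
  have hHerm : (Hham n).IsHermitian := by
    have h : IsSelfAdjoint (Hham n) := by
      rw [Hham_eq_sum]
      exact isSelfAdjoint_sum _ fun p _ => (IsSelfAdjoint.one _).sub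
        (isStarProjection_Pproj (gen_mul_self p) (gen_conjTranspose p)).isSelfAdjoint
    exact h
  have hker : ∀ b, T (Hham n) b = 0 → E b = b := by
    intro b hb
    have h0 := hquad b
    rw [hb, inner_zero_right, map_zero, eq_comm,
      Finset.sum_eq_zero_iff_of_nonneg fun _ _ => by positivity] at h0
    have hfix : ∀ p, Pproj (gen p) *ᵥ b.ofLp = b.ofLp := fun p => by
      have h1 : b - P p b = 0 := by simpa using h0 p (mem_univ p)
      rw [← ofLp_toEuclideanCLM]
      exact congrArg WithLp.ofLp (sub_eq_zero.mp h1).symm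
    refine WithLp.ofLp_injective 2 ?_
    rw [hEdef, hT, ofLp_toEuclideanCLM, Mmat_mulVec_eq_self μ hfix]
  have hgap : ∀ φ, E φ = 0 → specGap (Hham n) * ‖φ‖ ^ 2 ≤ ∑ p, ‖φ - P p φ‖ ^ 2 := by
    intro φ hφ
    rw [← hquad]
    refine specGap_mul_norm_sq_le hHerm (fun x => ?_) fun b hb => ?_
    · rw [← hT, hquad]
      positivity
    · rw [← hker b hb, hE.inner_apply_left, hφ, inner_zero_right]
  have hbound := norm_prod_sub_le hP
    (fun p q hpq => (Pproj_commute (gen_mul_self p) (gen_mul_self q) (gen_commute hpq)).map T)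
    (fun _ _ => gateRel_comm) three_ne_zero card_gateRel_le hE hPE (genList n) nodup_genList
    mem_genList (specGap_nonneg (Hham n)) hgap
  have hpow : T (MvnPowMat n k - Mmat μ 2) = (((genList n).map P).prod - E) ^ k := by
    rw [← sub_pow_of_mul_eq (prod_mul_eq_of_forall hPE _) (mul_prod_eq_of_forall hEP _)
      hE.isIdempotentElem hk, map_sub, MvnPowMat_eq_pow, map_pow, map_list_prod, List.map_map]
    rfl
  change ‖T (MvnPowMat n k - Mmat μ 2)‖ ≤ _
  have hΔ := specGap_nonneg (Hham n)
  rw [hpow]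
  calc _ ≤ ‖((genList n).map P).prod - E‖ ^ k := norm_pow_le' _ hk
    _ ≤ ((1 + specGap (Hham n) / ((3 : ℕ) : ℝ) ^ 2) ^ (-(1 / 2) : ℝ)) ^ k := by gcongr
    _ = _ := by
      rw [← Real.rpow_natCast, ← Real.rpow_mul (by positivity)]
      norm_num
      congr 1
      ring
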